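/- Fix w* > 0 and γ ∈ (1,2), and let T(w) = w - (γ/σ'(w*))·(σ(w) - σ(w*)). Let w̃ > w* be the unique point with T(w̃) = w*. If w_t ∈ (w*, w̃) and T(w_t) < w*, then for all k ∈ ℕ, the iterates w_{t+2k} (iterating T) satisfy w_{t+2k} - w* < (1 - (2-γ)/γ)^k · (w_t - w*), i.e., two-step linear convergence with rate 1 - (2-γ)/γ in the oscillatory neighbourhood. -/

import Mathlib

noncomputable def sigmoid (w : ℝ) : ℝ := 1 / (1 + Real.exp (-w))

theorem sig_hasDeriv (c : ℝ) : HasDerivAt sigmoid (sigmoid c * (1 - sigmoid c)) c := by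
  have hp : 0 < 1 + Real.exp (-c) := by positivity
  have h1 : HasDerivAt (fun w : ℝ => 1 + Real.exp (-w)) (-Real.exp (-c)) c := by
    have := ((hasDerivAt_id c).neg.exp).const_add 1
    simpa using this
  have h2 := h1.inv hp.ne'
  have h3 : sigmoid = (fun w : ℝ => 1 + Real.exp (-w))⁻¹ := by
    funext w; simp [sigmoid]
  rw [← h3] at h2
  have h4 : sigmoid c * (1 - sigmoid c) = - -Real.exp (-c) / (1 + Real.exp (-c)) ^ 2 := by
    unfold sigmoid
    field_simp
    ring
  rw [h4]
  exact h2

theorem sig_mono : Monotone sigmoid := by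
  intro x y h
  unfold sigmoid
  have : Real.exp (-y) ≤ Real.exp (-x) := Real.exp_le_exp.2 (by linarith)
  apply one_div_le_one_div_of_le (by positivity)
  linarith

theorem sig_half {x : ℝ} (h : 0 ≤ x) : 1 / 2 ≤ sigmoid x := by
  have := sig_mono h
  have h0 : sigmoid 0 = 1 / 2 := by simp [sigmoid]; norm_num
  linarith

theorem sig_concave : ConcaveOn ℝ (Set.Ici 0) sigmoid := by
  apply AntitoneOn.concaveOn_of_deriv (convex_Ici 0)
  · exact fun x _ => (sig_hasDeriv x).continuousAt.continuousWithinAt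
  · exact fun x _ => (sig_hasDeriv x).differentiableAt.differentiableWithinAt
  · intro x hx y hy hxy
    rw [interior_Ici] at hx hy
    rw [(sig_hasDeriv x).deriv, (sig_hasDeriv y).deriv]
    have h1 := sig_half (le_of_lt hx)
    have h2 := sig_mono hxy
    nlinarith

theorem sig_chord {c u d : ℝ} (hc : 0 < c) (hu : 0 < u) (hud : u ≤ d) :
    (sigmoid (c + d) - sigmoid c) * u ≤ (sigmoid (c + u) - sigmoid c) * d := by
  have hd : 0 < d := by linarith
  have h := sig_concave.2 (Set.mem_Ici.2 hc.le)
    (Set.mem_Ici.2 (show 0 ≤ c + d by linarith))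
    (show 0 ≤ 1 - u / d by rw [sub_nonneg, div_le_one hd]; exact hud)
    (show 0 ≤ u / d by positivity) (by ring)
  have e : (1 - u / d) • c + (u / d) • (c + d) = c + u := by
    simp only [smul_eq_mul]; field_simp; ring
  rw [e] at h
  simp only [smul_eq_mul] at h
  have h2 : (sigmoid (c + d) - sigmoid c) * (u / d) ≤ sigmoid (c + u) - sigmoid c := by linarith
  have h3 := mul_le_mul_of_nonneg_right h2 hd.le
  have e3 : (sigmoid (c + d) - sigmoid c) * (u / d) * d = (sigmoid (c + d) - sigmoid c) * u := by
    field_simp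
  linarith

/-- the Pade bound -/
theorem pade {u : ℝ} (hu : 0 ≤ u) : Real.exp u * (2 - u) ≤ 2 + u := by
  have hm : MonotoneOn (fun x : ℝ => (2 + x) - Real.exp x * (2 - x)) (Set.Ici 0) := by
    have hd : ∀ x : ℝ, HasDerivAt (fun x : ℝ => (2 + x) - Real.exp x * (2 - x))
        (1 - (Real.exp x * (2 - x) + Real.exp x * (-1))) x := by
      intro x
      exact ((hasDerivAt_id x).const_add 2).sub
        ((Real.hasDerivAt_exp x).mul ((hasDerivAt_id x).const_sub 2))
    apply monotoneOn_of_deriv_nonneg (convex_Ici 0)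
    · exact fun x _ => (hd x).continuousAt.continuousWithinAt
    · exact fun x _ => (hd x).differentiableAt.differentiableWithinAt
    · intro x _
      rw [(hd x).deriv]
      have h1 : 1 - x ≤ Real.exp (-x) := by linarith [Real.add_one_le_exp (-x)]
      have h2 : Real.exp x * Real.exp (-x) = 1 := by rw [← Real.exp_add]; simp
      nlinarith [Real.exp_pos x]
  have := hm (Set.mem_Ici.2 le_rfl) (Set.mem_Ici.2 hu) hu
  simp at this
  linarith

theorem sig_right {c d : ℝ} (hd : 0 ≤ d) :
    (sigmoid (c + d) - sigmoid c) * (1 + (2 * sigmoid c - 1) * d / 2)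
      ≤ sigmoid c * (1 - sigmoid c) * d := by
  have hp := pade hd
  have e : Real.exp (-(c + d)) = Real.exp (-c) * Real.exp (-d) := by
    rw [← Real.exp_add]; ring_nf
  have h2 : Real.exp d * Real.exp (-d) = 1 := by rw [← Real.exp_add]; simp
  unfold sigmoid
  rw [e]
  have hr := Real.exp_pos (-c)
  have hE := Real.exp_pos (-d)
  have hp2 : 2 - d ≤ Real.exp (-d) * (2 + d) := by
    have := mul_le_mul_of_nonneg_left hp hE.le
    have e2 : Real.exp (-d) * (Real.exp d * (2 - d)) = 2 - d := by
      linear_combination (2 - d) * h2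
    linarith
  generalize Real.exp (-c) = r at *
  generalize Real.exp (-d) = E at *
  have key : 0 ≤ r * (1 + r) * (E * (2 + d) - (2 - d)) := by
    apply mul_nonneg (by positivity); linarith
  rw [← sub_nonneg]
  have : 1 / (1 + r) * (1 - 1 / (1 + r)) * d - (1 / (1 + r * E) - 1 / (1 + r)) * (1 + (2 * (1 / (1 + r)) - 1) * d / 2) = r * (1 + r) * (E * (2 + d) - (2 - d)) / (2 * (1 + r) ^ 2 * (1 + r * E)) := by
    have : 1 + r * E ≠ 0 := by positivity
    field_simp
    ring
  rw [this]
  positivity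

theorem sig_left {c u : ℝ} (hu : 0 ≤ u) :
    (sigmoid c - sigmoid (c - u)) * (1 - (2 * sigmoid c - 1) * u / 2)
      ≤ sigmoid c * (1 - sigmoid c) * u := by
  have hp := pade hu
  have e : Real.exp (-(c - u)) = Real.exp (-c) * Real.exp u := by
    rw [← Real.exp_add]; ring_nf
  unfold sigmoid
  rw [e]
  have hr := Real.exp_pos (-c)
  have hE := Real.exp_pos u
  generalize Real.exp (-c) = r at *
  generalize Real.exp u = F at *
  have key : 0 ≤ r * (1 + r) * ((2 + u) - F * (2 - u)) := by
    apply mul_nonneg (by positivity); linarith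
  rw [← sub_nonneg]
  have : 1 / (1 + r) * (1 - 1 / (1 + r)) * u - (1 / (1 + r) - 1 / (1 + r * F)) * (1 - (2 * (1 / (1 + r)) - 1) * u / 2) = r * (1 + r) * ((2 + u) - F * (2 - u)) / (2 * (1 + r) ^ 2 * (1 + r * F)) := by
    have : 1 + r * F ≠ 0 := by positivity
    field_simp
    ring
  rw [this]
  positivity

theorem sig_refl {c u : ℝ} (hc : 0 < c) (hu : 0 ≤ u) :
    sigmoid (c + u) - sigmoid c ≤ sigmoid c - sigmoid (c - u) := by
  have e : Real.exp (-(c - u)) = Real.exp (-c) * Real.exp u := by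
    rw [← Real.exp_add]; ring_nf
  have e' : Real.exp (-(c + u)) = Real.exp (-c) / Real.exp u := by
    rw [← Real.exp_sub]; ring_nf
  have hr1 : Real.exp (-c) < 1 := Real.exp_lt_one_iff.2 (by linarith)
  have hF1 : 1 ≤ Real.exp u := Real.one_le_exp hu
  unfold sigmoid
  rw [e, e']
  have hr := Real.exp_pos (-c)
  generalize Real.exp (-c) = r at *
  generalize Real.exp u = F at *
  have hF : 0 < F := by linarith
  rw [← sub_nonneg]
  have : 1 / (1 + r) - 1 / (1 + r * F) - (1 / (1 + r / F) - 1 / (1 + r)) = r * (F - 1) ^ 2 * (1 - r) / ((1 + r) * (1 + r * F) * (F + r)) := by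
    have : 1 + r * F ≠ 0 := by positivity
    have : F + r ≠ 0 := by positivity
    have : 1 + r / F ≠ 0 := by positivity
    field_simp
    ring
  rw [this]
  have : 0 < 1 - r := by linarith
  positivity

theorem alg_step {d u P Q m γ : ℝ} (hγ1 : 1 < γ) (hγ2 : γ < 2) (hd : 0 < d) (hu : 0 < u)
    (hm : 0 ≤ m) (hP : 0 < P) (hQ : 0 < Q) (h1 : P * (1 + m * d / 2) ≤ d)
    (h2 : Q * (1 - m * u / 2) ≤ u) (hup : u = γ * P - d) :
    γ * Q - u < (1 - (2 - γ) / γ) * d := by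
  have hPd : P ≤ d := by
    have : 0 ≤ P * (m * d / 2) := by positivity
    linarith
  have hy : 0 ≤ m * P / 2 := by positivity
  have hdy : P * (1 + m * P / 2) ≤ d := by
    have : P * (m * P / 2) ≤ P * (m * d / 2) := by gcongr
    linarith
  have huy : u ≤ P * (1 - m * P / 2) := by nlinarith
  have hmu : m * u / 2 ≤ m * P / 2 * (1 - m * P / 2) := by
    have := mul_le_mul_of_nonneg_left huy hm
    linarith
  generalize m * P / 2 = y at *
  have h3 : Q * (1 - y + y ^ 2) ≤ u := by
    have : Q * (1 - y + y ^ 2) ≤ Q * (1 - m * u / 2) := by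
      apply mul_le_mul_of_nonneg_left _ hQ.le; linarith
    linarith
  have h4 : Q ≤ u * (1 + y) := by
    have a1 := mul_le_mul_of_nonneg_right h3 (show 0 ≤ 1 + y by linarith)
    have a2 : 0 ≤ Q * y ^ 3 := by positivity
    nlinarith
  have h5 : P * Q ≤ u * d := by
    have a1 := mul_le_mul_of_nonneg_left h4 hP.le
    have a2 := mul_le_mul_of_nonneg_left hdy hu.le
    nlinarith
  have h6 : γ * Q - u ≤ (γ - 1) ^ 2 * d := by
    have a : (u + d) * Q ≤ γ * (u * d) := by
      have : u + d = γ * P := by linarith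
      rw [this]
      nlinarith
    have b : (u + d) * (γ * Q - u) ≤ (u + d) * ((γ - 1) ^ 2 * d) := by
      have := mul_le_mul_of_nonneg_left a (show 0 ≤ γ by linarith)
      nlinarith [sq_nonneg (u - (γ - 1) * d)]
    exact le_of_mul_le_mul_left b (by linarith)
  have h7 : (γ - 1) ^ 2 < 1 - (2 - γ) / γ := by
    have e : 1 - (2 - γ) / γ - (γ - 1) ^ 2 = (γ - 1) * (2 - γ) * (γ + 1) / γ := by
      have : γ ≠ 0 := by linarith
      field_simp
      ring
    have : 0 < (γ - 1) * (2 - γ) * (γ + 1) / γ := by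
      have : 0 < γ - 1 := by linarith
      have : 0 < 2 - γ := by linarith
      positivity
    linarith
  have := mul_lt_mul_of_pos_right h7 hd
  linarith

theorem two_step {c γ : ℝ} (hc : 0 < c) (hγ1 : 1 < γ) (hγ2 : γ < 2)
    (T : ℝ → ℝ)
    (hT : ∀ w, T w = w - (γ / deriv sigmoid c) * (sigmoid w - sigmoid c))
    (w : ℝ) (hw : c < w) (hcross : T w < c) :
    c < T (T w) ∧ T (T w) - c < (1 - (2 - γ) / γ) * (w - c) ∧ T (T (T w)) < c := by
  rw [(sig_hasDeriv c).deriv] at hT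
  have hs := sig_half hc.le
  have hs1 : sigmoid c < 1 := by
    unfold sigmoid
    rw [div_lt_one (by positivity)]
    linarith [Real.exp_pos (-c)]
  set a := sigmoid c * (1 - sigmoid c) with ha
  have hapos : 0 < a := mul_pos (by linarith) (by linarith)
  obtain ⟨d, hd⟩ : ∃ d, d = w - c := ⟨_, rfl⟩
  obtain ⟨u, hu⟩ : ∃ u, u = c - T w := ⟨_, rfl⟩
  have hd0 : 0 < d := by linarith
  have hu0 : 0 < u := by linarith
  have ew : w = c + d := by linarith
  have eT : T w = c - u := by linarith
  obtain ⟨P, hP⟩ : ∃ P, P = (sigmoid (c + d) - sigmoid c) / a := ⟨_, rfl⟩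
  obtain ⟨Q, hQ⟩ : ∃ Q, Q = (sigmoid c - sigmoid (c - u)) / a := ⟨_, rfl⟩
  have hup : u = γ * P - d := by
    rw [hu, hT, ew, hP]; ring
  have eTT : T (T w) - c = γ * Q - u := by
    rw [eT, hT, hQ]; ring
  have hPa : P * a = sigmoid (c + d) - sigmoid c := by rw [hP]; field_simp
  have hQa : Q * a = sigmoid c - sigmoid (c - u) := by rw [hQ]; field_simp
  have hγP : d < γ * P := by linarith
  have hP0 : 0 < P := by
    by_contra h
    push Not at h
    nlinarith
  have hm : 0 ≤ 2 * sigmoid c - 1 := by linarith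
  have h1 : P * (1 + (2 * sigmoid c - 1) * d / 2) ≤ d := by
    have := sig_right (c := c) hd0.le
    rw [← hPa, ← ha] at this
    refine le_of_mul_le_mul_left (a := a) ?_ hapos
    linarith
  have h2 : Q * (1 - (2 * sigmoid c - 1) * u / 2) ≤ u := by
    have := sig_left (c := c) hu0.le
    rw [← hQa, ← ha] at this
    refine le_of_mul_le_mul_left (a := a) ?_ hapos
    linarith
  have hPd : P ≤ d := by
    have : 0 ≤ P * ((2 * sigmoid c - 1) * d / 2) := by positivity
    linarith
  have hud : u ≤ d := by nlinarith
  -- chord comparison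
  have hch : ∀ x, 0 < x → x ≤ d → x * a < γ * (sigmoid (c + x) - sigmoid c) := by
    intro x hx hxd
    have h := sig_chord hc hx hxd
    rw [← hPa] at h
    have h' := mul_le_mul_of_nonneg_left h (show 0 ≤ γ by linarith)
    have h'' : d * (a * x) < γ * P * (a * x) := mul_lt_mul_of_pos_right hγP (by positivity)
    refine lt_of_mul_lt_mul_left (a := d) ?_ hd0.le
    linarith
  have hQu : u < γ * Q := by
    have h := hch u hu0 hud
    have h' := sig_refl hc hu0.le
    rw [← hQa] at h'
    have h'' := mul_le_mul_of_nonneg_left h' (show 0 ≤ γ by linarith)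
    refine lt_of_mul_lt_mul_right (a := a) ?_ hapos.le
    linarith
  have hQ0 : 0 < Q := by
    by_contra h
    push Not at h
    nlinarith
  have hmain := alg_step hγ1 hγ2 hd0 hu0 hm hP0 hQ0 h1 h2 hup
  refine ⟨by linarith, by rw [eTT, ← hd]; exact hmain, ?_⟩
  have hρ : 1 - (2 - γ) / γ ≤ 1 := by
    have : 0 ≤ (2 - γ) / γ := div_nonneg (by linarith) (by linarith)
    linarith
  have hle : T (T w) - c ≤ d := by
    have := mul_le_mul_of_nonneg_right hρ hd0.le
    linarith
  have h := hch (T (T w) - c) (by linarith) hle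
  rw [add_sub_cancel] at h
  rw [hT (T (T w))]
  have h' : T (T w) - c < γ / a * (sigmoid (T (T w)) - sigmoid c) := by
    rw [div_mul_eq_mul_div, lt_div_iff₀ hapos]; exact h
  linarith

theorem two_step_linear_rate_in_oscillatory_neighbourhood
    (wstar γ : ℝ) (hwstar : 0 < wstar) (hγ1 : 1 < γ) (hγ2 : γ < 2)
    (T : ℝ → ℝ)
    (hT : ∀ w, T w = w - (γ / deriv sigmoid wstar) * (sigmoid w - sigmoid wstar))
    (wtilde : ℝ) (hwtilde : wstar < wtilde) (hTtilde : T wtilde = wstar)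
    (wt : ℝ) (hwt1 : wstar < wt) (hwt2 : wt < wtilde) (hcross : T wt < wstar) :
    ∀ k : ℕ, 1 ≤ k → T^[2 * k] wt - wstar < (1 - (2 - γ) / γ) ^ k * (wt - wstar) := by
  have hρ : 0 < 1 - (2 - γ) / γ := by
    rw [sub_pos, div_lt_one (by linarith)]; linarith
  have hstep : ∀ k : ℕ, T^[2 * (k + 1)] wt = T (T (T^[2 * k] wt)) := by
    intro k
    rw [show 2 * (k + 1) = 2 * k + 1 + 1 by ring, Function.iterate_succ_apply',
      Function.iterate_succ_apply']
  have inv : ∀ k : ℕ, wstar < T^[2 * k] wt ∧ T (T^[2 * k] wt) < wstar := by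
    intro k
    induction k with
    | zero => simpa using ⟨hwt1, hcross⟩
    | succ k ih =>
      rw [hstep]
      have := two_step hwstar hγ1 hγ2 T hT _ ih.1 ih.2
      exact ⟨this.1, this.2.2⟩
  have bd : ∀ k : ℕ, T^[2 * k] wt - wstar ≤ (1 - (2 - γ) / γ) ^ k * (wt - wstar) ∧
      T^[2 * (k + 1)] wt - wstar < (1 - (2 - γ) / γ) ^ (k + 1) * (wt - wstar) := by
    intro k
    have hs : T^[2 * k] wt - wstar ≤ (1 - (2 - γ) / γ) ^ k * (wt - wstar) →
        T^[2 * (k + 1)] wt - wstar < (1 - (2 - γ) / γ) ^ (k + 1) * (wt - wstar) := by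
      intro h
      rw [hstep]
      have := (two_step hwstar hγ1 hγ2 T hT _ (inv k).1 (inv k).2).2.1
      have h' := mul_le_mul_of_nonneg_left h hρ.le
      rw [pow_succ']
      linarith
    induction k with
    | zero =>
      have h0 : T^[2 * 0] wt - wstar ≤ (1 - (2 - γ) / γ) ^ 0 * (wt - wstar) := by simp
      exact ⟨h0, hs h0⟩
    | succ k ih =>
      have h0 := (ih (fun h => by
        rw [hstep]
        have := (two_step hwstar hγ1 hγ2 T hT _ (inv k).1 (inv k).2).2.1
        have h' := mul_le_mul_of_nonneg_left h hρ.le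
        rw [pow_succ']
        linarith)).2.le
      exact ⟨h0, hs h0⟩
  intro k hk
  obtain ⟨j, rfl⟩ : ∃ j, k = j + 1 := ⟨k - 1, by omega⟩
  exact (bd j).2
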